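/- Let C₁ and C₂ be distinct smooth conics in ℙ²(ℂ) meeting transversally in four points n₁, n₂, n₃, n₄, and let L be a line tangent to both C₁ and C₂ and containing none of the points nᵢ. If D₁ and D₂ are smooth conics, each passing through all of n₁, n₂, n₃, n₄ and each tangent to L, with D₁ ≠ D₂, then {D₁, D₂} = {C₁, C₂}. Consequently a split quartic C₁ ∪ C₂ is determined by its four nodes together with one of its bitangent lines. -/

import Mathlib

open MvPolynomial

noncomputable section

abbrev P2 : Type := Projectivization ℂ (Fin 3 → ℂ)

/-- The zero locus in `ℙ²` of a polynomial `F`: the points all of whose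
representative vectors are zeros of `F`. -/
def curve (F : MvPolynomial (Fin 3) ℂ) : Set P2 :=
  {p | ∀ (w : Fin 3 → ℂ) (hw : w ≠ 0), Projectivization.mk ℂ w hw = p → eval w F = 0}

/-- The projective line spanned by two vectors. -/
def lineThrough (u v : Fin 3 → ℂ) : Set P2 :=
  {p | ∃ s t : ℂ, ∃ h : s • u + t • v ≠ 0, p = Projectivization.mk ℂ (s • u + t • v) h}

/-- A subset of `ℙ²` is a line if it is the projective span of two
linearly independent vectors. -/
def IsLine (S : Set P2) : Prop :=
  ∃ u v : Fin 3 → ℂ, LinearIndependent ℂ ![u, v] ∧ S = lineThrough u v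

/-- The restriction of `F` to the affine parametrization `t ↦ a + t • b` of the line
through `[a]` and `[b]`, as a polynomial in `t`. -/
def lineRest (F : MvPolynomial (Fin 3) ℂ) (a b : Fin 3 → ℂ) : Polynomial ℂ :=
  eval₂ Polynomial.C (fun i => Polynomial.C (a i) + Polynomial.X * Polynomial.C (b i)) F

/-- The local intersection multiplicity, at the point `[a]`, of the curve `F = 0` with the
line through `[a]` and `[b]` (parametrized by `t ↦ a + t • b`, the point `[a]`
corresponding to `t = 0`). -/
def multAt (F : MvPolynomial (Fin 3) ℂ) (a b : Fin 3 → ℂ) : ℕ :=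
  Polynomial.rootMultiplicity 0 (lineRest F a b)

/-- The scheme `X ∩ L` (for `X = {F = 0}`, `L` a line) is everywhere nonreduced: at each
point of `X ∩ L` the local intersection multiplicity is at least `2`.  (Stated over all
parametrizations of `L`; the base point `a` of a parametrization is a point of `L`, and
every point of `L` occurs as such a base point.) -/
def EverywhereTangent (F : MvPolynomial (Fin 3) ℂ) (S : Set P2) : Prop :=
  ∀ a b : Fin 3 → ℂ, LinearIndependent ℂ ![a, b] → S = lineThrough a b →
    ∀ ha : a ≠ 0, Projectivization.mk ℂ a ha ∈ curve F → 2 ≤ multAt F a b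

/-- A theta-line of the quartic `F`: either contained in the curve, or intersecting it
everywhere nonreducedly. -/
def ThetaLine (F : MvPolynomial (Fin 3) ℂ) (S : Set P2) : Prop :=
  IsLine S ∧ (S ⊆ curve F ∨ EverywhereTangent F S)

/-- A bitangent line of (a smooth curve) `F = 0`: a line, not contained in the curve,
whose scheme-theoretic intersection with the curve is everywhere nonreduced. -/
def Bitangent (F : MvPolynomial (Fin 3) ℂ) (S : Set P2) : Prop :=
  IsLine S ∧ ¬ S ⊆ curve F ∧ EverywhereTangent F S

/-- The line `S` is tangent to the curve `F = 0` at the point `q`: the local intersection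
multiplicity there is at least `2`. -/
def TangentAt (F : MvPolynomial (Fin 3) ℂ) (S : Set P2) (q : P2) : Prop :=
  IsLine S ∧ q ∈ S ∧ q ∈ curve F ∧
    ∀ a b : Fin 3 → ℂ, LinearIndependent ℂ ![a, b] → S = lineThrough a b →
      ∀ ha : a ≠ 0, Projectivization.mk ℂ a ha = q → 2 ≤ multAt F a b

/-- The curve `F = 0` is smooth: `F` and its partial derivatives have no common
projective zero. -/
def SmoothCurve (F : MvPolynomial (Fin 3) ℂ) : Prop :=
  ∀ w : Fin 3 → ℂ, w ≠ 0 → ¬ (eval w F = 0 ∧ ∀ i : Fin 3, eval w (pderiv i F) = 0)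

/-- Iterated partial derivative along a list of coordinate directions. -/
def pderivList (l : List (Fin 3)) (F : MvPolynomial (Fin 3) ℂ) : MvPolynomial (Fin 3) ℂ :=
  l.foldr (fun i G => pderiv i G) F

/-- `F` vanishes to order at least `m` at the point `p` (all partial derivatives of
order `< m` vanish at `p`); i.e. `p` is a point of multiplicity at least `m` of `F = 0`. -/
def VanishesToOrder (F : MvPolynomial (Fin 3) ℂ) (p : P2) (m : ℕ) : Prop :=
  ∀ l : List (Fin 3), l.length < m →
    ∀ (w : Fin 3 → ℂ) (hw : w ≠ 0), Projectivization.mk ℂ w hw = p →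
      eval w (pderivList l F) = 0

/-- `p` is a singular point of the curve `F = 0`. -/
def IsSingularAt (F : MvPolynomial (Fin 3) ℂ) (p : P2) : Prop :=
  VanishesToOrder F p 2

/-- `p` is a double point: a point of multiplicity exactly `2`. -/
def IsDoublePoint (F : MvPolynomial (Fin 3) ℂ) (p : P2) : Prop :=
  VanishesToOrder F p 2 ∧ ¬ VanishesToOrder F p 3

/-- The quadratic form (in the direction `b`) cutting out the tangent cone of `F = 0`
at the double point `[a]`: the degree-`2` Taylor coefficient of `t ↦ F (a + t • b)`. -/
def coneCoeff (F : MvPolynomial (Fin 3) ℂ) (a b : Fin 3 → ℂ) : ℂ :=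
  (lineRest F a b).coeff 2

/-- `p` is an ordinary node: a double point whose tangent cone consists of two distinct
lines, i.e. the tangent-cone quadratic has two null directions independent modulo `a`. -/
def OrdinaryNode (F : MvPolynomial (Fin 3) ℂ) (p : P2) : Prop :=
  IsDoublePoint F p ∧
    ∀ (a : Fin 3 → ℂ) (ha : a ≠ 0), Projectivization.mk ℂ a ha = p →
      ∃ b₁ b₂ : Fin 3 → ℂ, LinearIndependent ℂ ![a, b₁, b₂] ∧
        coneCoeff F a b₁ = 0 ∧ coneCoeff F a b₂ = 0

/-- At the double point `[a]`, the tangent cone is the double line through `[a]` and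
`[b₀]`: `b₀` is a null direction of the tangent-cone quadratic, and every null
direction lies on the line spanned by `a` and `b₀`. -/
def DoubleLineCone (F : MvPolynomial (Fin 3) ℂ) (a b₀ : Fin 3 → ℂ) : Prop :=
  LinearIndependent ℂ ![a, b₀] ∧ coneCoeff F a b₀ = 0 ∧
    ∀ b : Fin 3 → ℂ, coneCoeff F a b = 0 → b ∈ Submodule.span ℂ ({a, b₀} : Set (Fin 3 → ℂ))

/-- `p` is an ordinary cusp: a double point whose tangent cone is a double line `L₀`
with local intersection multiplicity `i(L₀ · X) = 3` at `p`. -/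
def OrdinaryCusp (F : MvPolynomial (Fin 3) ℂ) (p : P2) : Prop :=
  IsDoublePoint F p ∧
    ∀ (a : Fin 3 → ℂ) (ha : a ≠ 0), Projectivization.mk ℂ a ha = p →
      ∃ b₀ : Fin 3 → ℂ, DoubleLineCone F a b₀ ∧ multAt F a b₀ = 3

/-- `p` is an ordinary tacnode: a double point whose tangent cone is a double line `L₀`
with local intersection multiplicity `i(L₀ · X) = 4` at `p`. -/
def OrdinaryTacnode (F : MvPolynomial (Fin 3) ℂ) (p : P2) : Prop :=
  IsDoublePoint F p ∧
    ∀ (a : Fin 3 → ℂ) (ha : a ≠ 0), Projectivization.mk ℂ a ha = p →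
      ∃ b₀ : Fin 3 → ℂ, DoubleLineCone F a b₀ ∧ multAt F a b₀ = 4

/-- A theta-line of type `i`: a theta-line, not a component of the curve, containing
exactly `i` singular points of the curve. -/
def ThetaLineOfType (F : MvPolynomial (Fin 3) ℂ) (i : ℕ) (S : Set P2) : Prop :=
  ThetaLine F S ∧ ¬ S ⊆ curve F ∧ {p | p ∈ S ∧ IsSingularAt F p}.ncard = i

/-- Three points of `ℙ²` are collinear. -/
def Collin (p q r : P2) : Prop :=
  ∃ S : Set P2, IsLine S ∧ p ∈ S ∧ q ∈ S ∧ r ∈ S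


/-- An ordinary bitangent: a bitangent meeting the curve at exactly two distinct points,
each with local intersection multiplicity exactly `2`. -/
def OrdinaryBitangent (F : MvPolynomial (Fin 3) ℂ) (S : Set P2) : Prop :=
  Bitangent F S ∧ (S ∩ curve F).ncard = 2 ∧
    ∀ a b : Fin 3 → ℂ, LinearIndependent ℂ ![a, b] → S = lineThrough a b →
      ∀ ha : a ≠ 0, Projectivization.mk ℂ a ha ∈ curve F → multAt F a b = 2

/-- A bitangent meeting the curve only at smooth points. -/
def SmoothBitangent (F : MvPolynomial (Fin 3) ℂ) (S : Set P2) : Prop :=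
  Bitangent F S ∧ ∀ p ∈ S ∩ curve F, ¬ IsSingularAt F p

theorem exists_single_add_single_of_degree_eq_two {σ : Type*} (d : σ →₀ ℕ) (hd : d.degree = 2) :
    ∃ i j, d = Finsupp.single i 1 + Finsupp.single j 1 := by
  classical
  have hm : Multiset.card (Finsupp.toMultiset d) = 2 := by
    rw [Finsupp.card_toMultiset, ← hd]; rfl
  obtain ⟨i, j, hij⟩ := Multiset.card_eq_two.1 hm
  refine ⟨i, j, Multiset.toFinsupp.symm.injective ?_⟩
  change Finsupp.toMultiset d = Finsupp.toMultiset _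
  rw [hij, map_add, Finsupp.toMultiset_single, Finsupp.toMultiset_single]
  rfl

/-- A homogeneous polynomial of degree `2` evaluates as a quadratic form. -/
theorem exists_quadraticForm_eval {F : MvPolynomial (Fin 3) ℂ} (hF : F.IsHomogeneous 2) :
    ∃ q : QuadraticForm ℂ (Fin 3 → ℂ), ∀ w, q w = eval w F := by
  have h : ∀ d ∈ F.support, ∃ i j, d = Finsupp.single i 1 + Finsupp.single j 1 := fun d hd =>
    exists_single_add_single_of_degree_eq_two d
      (by rw [Finsupp.degree_eq_weight_one]; exact hF (mem_support_iff.1 hd))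
  choose! i j hij using h
  refine ⟨∑ d ∈ F.support, F.coeff d • QuadraticMap.proj (i d) (j d), fun w => ?_⟩
  rw [_root_.sum_apply, eval_eq]
  refine Finset.sum_congr rfl fun d hd => ?_
  have hprod : ∏ k, w k ^ d k = w (i d) * w (j d) := by
    conv_lhs => rw [hij d hd]
    simp only [Finsupp.add_apply, pow_add, Finset.prod_mul_distrib]
    simp [Finsupp.single_apply, pow_ite]
  have hsupp : ∏ k ∈ d.support, w k ^ d k = ∏ k, w k ^ d k :=
    Finset.prod_subset (Finset.subset_univ _) fun k _ hk => by
      rw [Finsupp.notMem_support_iff.1 hk, pow_zero]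
  rw [hsupp, hprod, _root_.smul_apply, QuadraticMap.proj_apply, smul_eq_mul]

theorem mk_mem_curve {F : MvPolynomial (Fin 3) ℂ} {q : QuadraticForm ℂ (Fin 3 → ℂ)}
    (hq : ∀ w, q w = eval w F) {v : Fin 3 → ℂ} (hv : v ≠ 0) :
    Projectivization.mk ℂ v hv ∈ curve F ↔ q v = 0 := by
  refine ⟨fun h => (hq v).trans (h v hv rfl), fun h w hw hwv => ?_⟩
  obtain ⟨a, ha⟩ := (Projectivization.mk_eq_mk_iff' ℂ w v hw hv).1 hwv
  rw [← hq, ← ha, QuadraticMap.map_smul, h, smul_zero]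

theorem mem_curve_iff_rep {F : MvPolynomial (Fin 3) ℂ} {q : QuadraticForm ℂ (Fin 3 → ℂ)}
    (hq : ∀ w, q w = eval w F) (p : P2) : p ∈ curve F ↔ q p.rep = 0 := by
  conv_lhs => rw [← p.mk_rep]
  exact mk_mem_curve hq p.rep_nonzero

theorem curve_eq_of_proportional {F G : MvPolynomial (Fin 3) ℂ}
    {q r : QuadraticForm ℂ (Fin 3 → ℂ)} (hq : ∀ w, q w = eval w F) (hr : ∀ w, r w = eval w G)
    {a : ℂ} (ha : a ≠ 0) (h : ∀ w, q w = a * r w) : curve F = curve G := by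
  ext p
  rw [mem_curve_iff_rep hq, mem_curve_iff_rep hr, h]
  simp [ha]

theorem quadraticForm_pair (q : QuadraticForm ℂ (Fin 3 → ℂ)) (u v : Fin 3 → ℂ) (s t : ℂ) :
    q (s • u + t • v) = s ^ 2 * q u + s * t * QuadraticMap.polar q u v + t ^ 2 * q v := by
  rw [QuadraticMap.map_add q, QuadraticMap.map_smul, QuadraticMap.map_smul,
    QuadraticMap.polar_smul_left, QuadraticMap.polar_smul_right]
  simp only [smul_eq_mul]
  ring

theorem linearIndependent_rep_of_ne {p q : P2} (h : p ≠ q) :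
    LinearIndependent ℂ ![p.rep, q.rep] := by
  rw [LinearIndependent.pair_iff' p.rep_nonzero]
  intro a ha
  apply h
  rw [← p.mk_rep, ← q.mk_rep]
  exact ((Projectivization.mk_eq_mk_iff' ℂ _ _ q.rep_nonzero p.rep_nonzero).2 ⟨a, ha⟩).symm

/-- Proportional vectors in the plane spanned by `u, v` have proportional coordinates. -/
theorem mul_eq_mul_of_mk_eq {u v : Fin 3 → ℂ} (huv : LinearIndependent ℂ ![u, v])
    {s t s' t' : ℂ} (h : s • u + t • v ≠ 0) (h' : s' • u + t' • v ≠ 0)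
    (hmk : Projectivization.mk ℂ _ h = Projectivization.mk ℂ _ h') : s * t' = s' * t := by
  obtain ⟨a, ha⟩ := (Projectivization.mk_eq_mk_iff' ℂ _ _ h h').1 hmk
  have h0 : (a * s' - s) • u + (a * t' - t) • v = 0 := by
    rw [← sub_eq_zero] at ha
    rw [← ha]; module
  obtain ⟨h1, h2⟩ := LinearIndependent.pair_iff.1 huv _ _ h0
  linear_combination (-t') * h1 + s' * h2

/-- Two conics meeting in finitely many points have no three collinear common points. -/
theorem rep_ne_of_finite_inter {F G : MvPolynomial (Fin 3) ℂ}
    {q r : QuadraticForm ℂ (Fin 3 → ℂ)} (hq : ∀ w, q w = eval w F) (hr : ∀ w, r w = eval w G)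
    (hfin : (curve F ∩ curve G).Finite) {x y z : P2} (hx : x ∈ curve F ∩ curve G)
    (hy : y ∈ curve F ∩ curve G) (hz : z ∈ curve F ∩ curve G) (hxy : x ≠ y) (hxz : x ≠ z)
    (hyz : y ≠ z) (s t : ℂ) : x.rep ≠ s • y.rep + t • z.rep := by
  intro h
  have hs : s ≠ 0 := by
    rintro rfl
    have := (LinearIndependent.pair_iff.1 (linearIndependent_rep_of_ne hxz) 1 (-t)
      (by rw [h]; module)).1
    exact one_ne_zero this
  have ht : t ≠ 0 := by
    rintro rfl
    have := (LinearIndependent.pair_iff.1 (linearIndependent_rep_of_ne hxy) 1 (-s)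
      (by rw [h]; module)).1
    exact one_ne_zero this
  have key : ∀ {H : MvPolynomial (Fin 3) ℂ} {f : QuadraticForm ℂ (Fin 3 → ℂ)},
      (∀ w, f w = eval w H) → x ∈ curve H → y ∈ curve H → z ∈ curve H →
      ∀ c : ℂ, f ((1 : ℂ) • y.rep + c • z.rep) = 0 := by
    intro H f hf hxH hyH hzH c
    rw [mem_curve_iff_rep hf] at hxH hyH hzH
    rw [h, quadraticForm_pair, hyH, hzH] at hxH
    have hp : QuadraticMap.polar f y.rep z.rep = 0 := by simpa [hs, ht] using hxH
    rw [quadraticForm_pair, hyH, hzH, hp]; ring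
  have hli := linearIndependent_rep_of_ne hyz
  have hne : ∀ c : ℂ, (1 : ℂ) • y.rep + c • z.rep ≠ 0 := fun c hc =>
    one_ne_zero (LinearIndependent.pair_iff.1 hli 1 c hc).1
  refine Set.infinite_of_injective_forall_mem (f := fun c : ℂ => Projectivization.mk ℂ _ (hne c))
    (fun c c' hcc => ?_) (fun c => ?_) hfin
  · simpa using (mul_eq_mul_of_mk_eq hli (hne c) (hne c') hcc).symm
  · exact ⟨(mk_mem_curve hq _).2 (key hq hx.1 hy.1 hz.1 c),
      (mk_mem_curve hr _).2 (key hr hx.2 hy.2 hz.2 c)⟩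

/-- The conics through four points in general position are those of the pencil spanned by
any two non-proportional ones. -/
theorem exists_pencil_of_general_position {q₁ q₂ r : QuadraticForm ℂ (Fin 3 → ℂ)}
    {v₁ v₂ v₃ v₄ : Fin 3 → ℂ} (hli : LinearIndependent ℂ ![v₁, v₂, v₃])
    (h₁ : ∀ s t : ℂ, v₄ ≠ s • v₁ + t • v₂) (h₂ : ∀ s t : ℂ, v₄ ≠ s • v₁ + t • v₃)
    (h₃ : ∀ s t : ℂ, v₄ ≠ s • v₂ + t • v₃)
    (hq₁ : q₁ v₁ = 0 ∧ q₁ v₂ = 0 ∧ q₁ v₃ = 0 ∧ q₁ v₄ = 0)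
    (hq₂ : q₂ v₁ = 0 ∧ q₂ v₂ = 0 ∧ q₂ v₃ = 0 ∧ q₂ v₄ = 0)
    (hr : r v₁ = 0 ∧ r v₂ = 0 ∧ r v₃ = 0 ∧ r v₄ = 0)
    (hne₁ : ∃ w, q₁ w ≠ 0) (hne₂ : ∃ w, q₂ w ≠ 0)
    (hprop : ∀ a : ℂ, a ≠ 0 → ¬ ∀ w, q₁ w = a * q₂ w) :
    ∃ l m : ℂ, ∀ w, r w = l * q₁ w + m * q₂ w := by
  have hexp : ∀ w : Fin 3 → ℂ, ∃ x y z : ℂ, w = x • v₁ + y • v₂ + z • v₃ := by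
    intro w
    let b := basisOfLinearIndependentOfCardEqFinrank hli (by simp)
    refine ⟨b.repr w 0, b.repr w 1, b.repr w 2, ?_⟩
    have := b.sum_repr w
    rw [Fin.sum_univ_three] at this
    simpa [b] using this.symm
  have hform : ∀ f : QuadraticForm ℂ (Fin 3 → ℂ), f v₁ = 0 → f v₂ = 0 → f v₃ = 0 →
      ∀ x y z : ℂ, f (x • v₁ + y • v₂ + z • v₃) = x * y * QuadraticMap.polar f v₁ v₂
        + x * z * QuadraticMap.polar f v₁ v₃ + y * z * QuadraticMap.polar f v₂ v₃ := by
    intro f f₁ f₂ f₃ x y z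
    rw [QuadraticMap.map_add f, quadraticForm_pair, QuadraticMap.map_smul,
      QuadraticMap.polar_add_left, QuadraticMap.polar_smul_left, QuadraticMap.polar_smul_left,
      QuadraticMap.polar_smul_right, QuadraticMap.polar_smul_right, f₁, f₂, f₃]
    simp only [smul_eq_mul]
    ring
  obtain ⟨a, b, c, habc⟩ := hexp v₄
  have ha : a ≠ 0 := by rintro rfl; exact h₃ b c (by rw [habc]; module)
  have hb : b ≠ 0 := by rintro rfl; exact h₂ a c (by rw [habc]; module)
  have hc : c ≠ 0 := by rintro rfl; exact h₁ a b (by rw [habc]; module)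
  have hform' : ∀ f : QuadraticForm ℂ (Fin 3 → ℂ), (f v₁ = 0 ∧ f v₂ = 0 ∧ f v₃ = 0 ∧ f v₄ = 0) →
      ∀ x y z : ℂ, f (x • v₁ + y • v₂ + z • v₃) =
        (x * y - y * z * a / c) * QuadraticMap.polar f v₁ v₂
        + (x * z - y * z * a / b) * QuadraticMap.polar f v₁ v₃ := by
    rintro f ⟨f₁, f₂, f₃, f₄⟩ x y z
    rw [habc, hform f f₁ f₂ f₃] at f₄
    rw [hform f f₁ f₂ f₃]
    field_simp
    linear_combination y * z * f₄
  have e₁ := hform' q₁ hq₁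
  have e₂ := hform' q₂ hq₂
  have e := hform' r hr
  generalize QuadraticMap.polar q₁ v₁ v₂ = p₁ at e₁
  generalize QuadraticMap.polar q₁ v₁ v₃ = p₁' at e₁
  generalize QuadraticMap.polar q₂ v₁ v₂ = p₂ at e₂
  generalize QuadraticMap.polar q₂ v₁ v₃ = p₂' at e₂
  generalize QuadraticMap.polar r v₁ v₂ = p at e
  generalize QuadraticMap.polar r v₁ v₃ = p' at e
  have hdet : p₁ * p₂' - p₁' * p₂ ≠ 0 := by
    intro hdet
    have hn₁ : p₁ ≠ 0 ∨ p₁' ≠ 0 := by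
      by_contra! hcon
      obtain ⟨w, hw⟩ := hne₁
      obtain ⟨x, y, z, rfl⟩ := hexp w
      exact hw (by rw [e₁, hcon.1, hcon.2]; ring)
    have hn₂ : p₂ ≠ 0 ∨ p₂' ≠ 0 := by
      by_contra! hcon
      obtain ⟨w, hw⟩ := hne₂
      obtain ⟨x, y, z, rfl⟩ := hexp w
      exact hw (by rw [e₂, hcon.1, hcon.2]; ring)
    obtain ⟨k, hk, k₁, k₂⟩ : ∃ k : ℂ, k ≠ 0 ∧ p₁ = k * p₂ ∧ p₁' = k * p₂' := by
      rcases hn₂ with h | h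
      · have hp : p₁ ≠ 0 := by
          rintro rfl
          simp_all
        refine ⟨p₁ / p₂, div_ne_zero hp h, by field_simp, ?_⟩
        field_simp
        linear_combination -hdet
      · have hp : p₁' ≠ 0 := by
          rintro rfl
          simp_all
        refine ⟨p₁' / p₂', div_ne_zero hp h, ?_, by field_simp⟩
        field_simp
        linear_combination hdet
    refine hprop k hk fun w => ?_
    obtain ⟨x, y, z, rfl⟩ := hexp w
    rw [e₁, e₂, k₁, k₂]
    ring
  refine ⟨(p * p₂' - p' * p₂) / (p₁ * p₂' - p₁' * p₂),
    (p₁ * p' - p₁' * p) / (p₁ * p₂' - p₁' * p₂), fun w => ?_⟩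
  obtain ⟨x, y, z, rfl⟩ := hexp w
  rw [e, e₁, e₂]
  generalize x * y - y * z * a / c = X
  generalize x * z - y * z * a / b = Y
  rw [div_mul_eq_mul_div, div_mul_eq_mul_div, ← add_div, eq_div_iff hdet]
  ring

/-- The restriction of a conic to a line meeting it in exactly one point is a nonzero binary
quadratic form with vanishing discriminant. -/
theorem discrim_eq_zero_of_existsUnique_mem_line {F : MvPolynomial (Fin 3) ℂ}
    {q : QuadraticForm ℂ (Fin 3 → ℂ)} (hq : ∀ w, q w = eval w F) {u v : Fin 3 → ℂ}
    (huv : LinearIndependent ℂ ![u, v]) (h : ∃! p : P2, p ∈ curve F ∩ lineThrough u v) :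
    discrim (q u) (QuadraticMap.polar q u v) (q v) = 0 ∧
      (q u ≠ 0 ∨ QuadraticMap.polar q u v ≠ 0 ∨ q v ≠ 0) := by
  have key : ∀ s t s' t' : ℂ, (s ≠ 0 ∨ t ≠ 0) → (s' ≠ 0 ∨ t' ≠ 0) →
      s ^ 2 * q u + s * t * QuadraticMap.polar q u v + t ^ 2 * q v = 0 →
      s' ^ 2 * q u + s' * t' * QuadraticMap.polar q u v + t' ^ 2 * q v = 0 →
      s * t' = s' * t := by
    intro s t s' t' h₀ h₀' h₁ h₁'
    have hne : ∀ s t : ℂ, (s ≠ 0 ∨ t ≠ 0) → s • u + t • v ≠ 0 := by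
      intro s t hst h0
      have := LinearIndependent.pair_iff.1 huv s t h0
      tauto
    rw [← quadraticForm_pair] at h₁ h₁'
    exact mul_eq_mul_of_mk_eq huv (hne s t h₀) (hne s' t' h₀')
      (h.unique ⟨(mk_mem_curve hq _).2 h₁, s, t, _, rfl⟩
        ⟨(mk_mem_curve hq _).2 h₁', s', t', _, rfl⟩)
  generalize q u = A, QuadraticMap.polar q u v = B, q v = C at key
  refine ⟨?_, ?_⟩
  · by_cases hA : A = 0
    · subst hA
      by_contra hB
      have hB' : B ≠ 0 := by rintro rfl; exact hB (by simp [discrim])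
      have := key 1 0 (-C) B (by simp) (by simp [hB']) (by ring) (by ring)
      simp_all
    · obtain ⟨d, hd⟩ := IsAlgClosed.exists_eq_mul_self (discrim A B C)
      have hA2 : 2 * A ≠ 0 := by simpa using hA
      have e : ∀ d', d' * d' = discrim A B C →
          (-B + d') ^ 2 * A + (-B + d') * (2 * A) * B + (2 * A) ^ 2 * C = 0 := by
        intro d' hd'
        rw [discrim] at hd'
        linear_combination A * hd'
      have := key (-B + d) (2 * A) (-B + -d) (2 * A) (Or.inr hA2) (Or.inr hA2) (e _ hd.symm)
        (e _ (by rw [hd]; ring))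
      have hd0 : d = 0 := by linear_combination (1 / 2) * mul_right_cancel₀ hA2 this
      rw [hd, hd0, zero_mul]
  · by_contra! hcon
    obtain ⟨rfl, rfl, rfl⟩ := hcon
    have := key 1 0 0 1 (by simp) (by simp) (by ring) (by ring)
    simp at this

/-- Two binary quadratic forms with vanishing mixed discriminant, one of which is the square of
a nonzero linear form, have a common zero. -/
theorem exists_common_zero {A₁ B₁ C₁ A₂ B₂ C₂ : ℂ} (h₁ : discrim A₁ B₁ C₁ = 0)
    (hn₁ : A₁ ≠ 0 ∨ B₁ ≠ 0 ∨ C₁ ≠ 0)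
    (h₁₂ : B₁ * B₂ - 2 * A₁ * C₂ - 2 * A₂ * C₁ = 0) :
    ∃ s t : ℂ, (s ≠ 0 ∨ t ≠ 0) ∧ s ^ 2 * A₁ + s * t * B₁ + t ^ 2 * C₁ = 0 ∧
      s ^ 2 * A₂ + s * t * B₂ + t ^ 2 * C₂ = 0 := by
  rw [discrim] at h₁
  by_cases hA : A₁ = 0
  · subst hA
    have hB : B₁ = 0 := by simpa using h₁
    subst hB
    have hC : C₁ ≠ 0 := by simpa using hn₁
    have hA₂ : A₂ = 0 := by simpa [hC] using h₁₂
    exact ⟨1, 0, by simp, by ring, by rw [hA₂]; ring⟩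
  · exact ⟨-B₁, 2 * A₁, Or.inr (by simpa using hA), by linear_combination (-A₁) * h₁,
      by linear_combination A₂ * h₁ - 2 * A₁ * h₁₂⟩

/-- Let `C₁, C₂` be distinct smooth conics meeting transversally in
four points `n₁, …, n₄`, and let `L` be a common tangent line containing none of the
`nᵢ`.  If `D₁ ≠ D₂` are smooth conics through all the `nᵢ`, each tangent to `L`, then
`{D₁, D₂} = {C₁, C₂}`; in particular the split quartic `C₁ ∪ C₂` is determined by its
four nodes together with one of its bitangents. -/
theorem split_quartic_determined_by_nodes_and_a_bitangent
    (Q₁ Q₂ : MvPolynomial (Fin 3) ℂ)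
    (hQ₁0 : Q₁ ≠ 0) (hQ₁2 : Q₁.IsHomogeneous 2) (hQ₁sm : SmoothCurve Q₁)
    (hQ₂0 : Q₂ ≠ 0) (hQ₂2 : Q₂.IsHomogeneous 2) (hQ₂sm : SmoothCurve Q₂)
    (hQne : curve Q₁ ≠ curve Q₂)
    (n₁ n₂ n₃ n₄ : P2)
    (hd12 : n₁ ≠ n₂) (hd13 : n₁ ≠ n₃) (hd14 : n₁ ≠ n₄)
    (hd23 : n₂ ≠ n₃) (hd24 : n₂ ≠ n₄) (hd34 : n₃ ≠ n₄)
    (hmeet : curve Q₁ ∩ curve Q₂ = {n₁, n₂, n₃, n₄})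
    (htrans : ∀ p ∈ curve Q₁ ∩ curve Q₂, ∀ S S' : Set P2,
      TangentAt Q₁ S p → TangentAt Q₂ S' p → S ≠ S')
    (L : Set P2) (hL : IsLine L)
    (hLQ₁ : ∃! p : P2, p ∈ curve Q₁ ∩ L) (hLQ₂ : ∃! p : P2, p ∈ curve Q₂ ∩ L)
    (hLn : n₁ ∉ L ∧ n₂ ∉ L ∧ n₃ ∉ L ∧ n₄ ∉ L)
    (R₁ R₂ : MvPolynomial (Fin 3) ℂ)
    (hR₁0 : R₁ ≠ 0) (hR₁2 : R₁.IsHomogeneous 2) (hR₁sm : SmoothCurve R₁)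
    (hR₂0 : R₂ ≠ 0) (hR₂2 : R₂.IsHomogeneous 2) (hR₂sm : SmoothCurve R₂)
    (hR₁n : n₁ ∈ curve R₁ ∧ n₂ ∈ curve R₁ ∧ n₃ ∈ curve R₁ ∧ n₄ ∈ curve R₁)
    (hR₂n : n₁ ∈ curve R₂ ∧ n₂ ∈ curve R₂ ∧ n₃ ∈ curve R₂ ∧ n₄ ∈ curve R₂)
    (hLR₁ : ∃! p : P2, p ∈ curve R₁ ∩ L) (hLR₂ : ∃! p : P2, p ∈ curve R₂ ∩ L)
    (hRne : curve R₁ ≠ curve R₂) :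
    ({curve R₁, curve R₂} : Set (Set P2)) = {curve Q₁, curve Q₂} := by
  obtain ⟨q₁, hq₁⟩ := exists_quadraticForm_eval hQ₁2
  obtain ⟨q₂, hq₂⟩ := exists_quadraticForm_eval hQ₂2
  obtain ⟨u, v, huv, rfl⟩ := hL
  obtain ⟨d₁, nz₁⟩ := discrim_eq_zero_of_existsUnique_mem_line hq₁ huv hLQ₁
  obtain ⟨d₂, -⟩ := discrim_eq_zero_of_existsUnique_mem_line hq₂ huv hLQ₂
  have hne : ∀ {F : MvPolynomial (Fin 3) ℂ} {q : QuadraticForm ℂ (Fin 3 → ℂ)},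
      (∀ w, q w = eval w F) → F ≠ 0 → ∃ w, q w ≠ 0 := by
    intro F q hq hF
    by_contra! hcon
    exact hF (MvPolynomial.funext fun w => by rw [← hq, hcon, map_zero])
  have hmixed : QuadraticMap.polar q₁ u v * QuadraticMap.polar q₂ u v
      - 2 * q₁ u * q₂ v - 2 * q₂ u * q₁ v ≠ 0 := by
    intro h
    obtain ⟨s, t, hst, z₁, z₂⟩ := exists_common_zero d₁ nz₁ h
    rw [← quadraticForm_pair] at z₁ z₂
    have h0 : s • u + t • v ≠ 0 := by
      intro h0
      have := LinearIndependent.pair_iff.1 huv s t h0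
      tauto
    have hmem : Projectivization.mk ℂ _ h0 ∈ curve Q₁ ∩ curve Q₂ :=
      ⟨(mk_mem_curve hq₁ _).2 z₁, (mk_mem_curve hq₂ _).2 z₂⟩
    have hline : Projectivization.mk ℂ _ h0 ∈ lineThrough u v := ⟨s, t, h0, rfl⟩
    rw [hmeet] at hmem
    obtain ⟨l₁, l₂, l₃, l₄⟩ := hLn
    rcases hmem with h | h | h | h <;> rw [h] at hline <;> contradiction
  have hfin : (curve Q₁ ∩ curve Q₂).Finite := by
    rw [hmeet]; exact Set.toFinite _
  have m₁ : n₁ ∈ curve Q₁ ∩ curve Q₂ := by rw [hmeet]; simp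
  have m₂ : n₂ ∈ curve Q₁ ∩ curve Q₂ := by rw [hmeet]; simp
  have m₃ : n₃ ∈ curve Q₁ ∩ curve Q₂ := by rw [hmeet]; simp
  have m₄ : n₄ ∈ curve Q₁ ∩ curve Q₂ := by rw [hmeet]; simp
  have hli : LinearIndependent ℂ ![n₁.rep, n₂.rep, n₃.rep] := by
    refine linearIndependent_finCons.2 ⟨linearIndependent_rep_of_ne hd23, fun hmem => ?_⟩
    rw [Matrix.range_cons, Matrix.range_cons, Matrix.range_empty, Set.union_empty,
      Set.singleton_union, Submodule.mem_span_pair] at hmem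
    obtain ⟨s, t, hst⟩ := hmem
    exact rep_ne_of_finite_inter hq₁ hq₂ hfin m₁ m₂ m₃ hd12 hd13 hd23 s t hst.symm
  have hmain : ∀ R : MvPolynomial (Fin 3) ℂ, R ≠ 0 → R.IsHomogeneous 2 →
      (n₁ ∈ curve R ∧ n₂ ∈ curve R ∧ n₃ ∈ curve R ∧ n₄ ∈ curve R) →
      (∃! p : P2, p ∈ curve R ∩ lineThrough u v) → curve R = curve Q₁ ∨ curve R = curve Q₂ := by
    intro R hR0 hR2 hRn hLR
    obtain ⟨r, hr⟩ := exists_quadraticForm_eval hR2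
    obtain ⟨l, m, hlm⟩ := exists_pencil_of_general_position (q₁ := q₁) (q₂ := q₂) (r := r) hli
      (rep_ne_of_finite_inter hq₁ hq₂ hfin m₄ m₁ m₂ hd14.symm hd24.symm hd12)
      (rep_ne_of_finite_inter hq₁ hq₂ hfin m₄ m₁ m₃ hd14.symm hd34.symm hd13)
      (rep_ne_of_finite_inter hq₁ hq₂ hfin m₄ m₂ m₃ hd24.symm hd34.symm hd23)
      (by simpa only [← mem_curve_iff_rep hq₁] using ⟨m₁.1, m₂.1, m₃.1, m₄.1⟩)
      (by simpa only [← mem_curve_iff_rep hq₂] using ⟨m₁.2, m₂.2, m₃.2, m₄.2⟩)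
      (by simpa only [← mem_curve_iff_rep hr] using hRn)
      (hne hq₁ hQ₁0) (hne hq₂ hQ₂0)
      (fun a ha hprop => hQne (curve_eq_of_proportional hq₁ hq₂ ha hprop))
    obtain ⟨d, -⟩ := discrim_eq_zero_of_existsUnique_mem_line hr huv hLR
    have hpolar : QuadraticMap.polar r u v =
        l * QuadraticMap.polar q₁ u v + m * QuadraticMap.polar q₂ u v := by
      simp only [QuadraticMap.polar, hlm]
      ring
    rw [hpolar, hlm, hlm] at d
    have hprod : l * m = 0 := by
      refine (mul_eq_zero.1 (?_ : l * m * _ = 0)).resolve_right hmixed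
      rw [discrim] at d d₁ d₂
      linear_combination (1 / 2) * d - (1 / 2) * l ^ 2 * d₁ - (1 / 2) * m ^ 2 * d₂
    obtain ⟨w, hw⟩ := hne hr hR0
    rcases mul_eq_zero.1 hprod with rfl | rfl
    · have hm : m ≠ 0 := by rintro rfl; exact hw (by rw [hlm]; ring)
      exact Or.inr (curve_eq_of_proportional hr hq₂ hm fun w => by rw [hlm]; ring)
    · have hl : l ≠ 0 := by rintro rfl; exact hw (by rw [hlm]; ring)
      exact Or.inl (curve_eq_of_proportional hr hq₁ hl fun w => by rw [hlm]; ring)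
  rcases hmain R₁ hR₁0 hR₁2 hR₁n hLR₁ with h₁ | h₁ <;>
    rcases hmain R₂ hR₂0 hR₂2 hR₂n hLR₂ with h₂ | h₂
  · exact absurd (h₁.trans h₂.symm) hRne
  · rw [h₁, h₂]
  · rw [h₁, h₂, Set.pair_comm]
  · exact absurd (h₁.trans h₂.symm) hRne

end
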